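/- arXiv:2112.12293 — 10 statements merged into one kernel-verified Lean document; each statement's English description precedes it below -/
import Mathlib

section
/- Let δ₊, δ₋, Λ, R, q² be real parameters with R > 0, and suppose c₀ + c₁ + c₂ ≠ 0 and c₀ − c₁ + c₂ ≠ 0. Then the metric function f_EIH satisfies f_EIH(1) = 0, f_EIH(−1) = 0, and its derivative satisfies the generalized regularity conditions f_EIH′(1) = −2(1 + δ₊/(2π)) and f_EIH′(−1) = +2(1 + δ₋/(2π)). -/
open Real

/-- Coefficient `d₀` of the EIH metric function (with `R2 = R²`). -/
noncomputable def d0EIH (δp δm Λ R2 q2 : ℝ) : ℝ :=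
  (2 / π) * (2 * π + δm) * (2 * π + δp) +
    (Λ * R2 / 3) * (4 * π * (Λ * R2 - 5) - 5 * (δm + δp) + q2)

/-- Coefficient `d₁` of the EIH metric function. -/
noncomputable def d1EIH (δp δm Λ R2 q2 : ℝ) : ℝ :=
  (4 / 3) * Λ * R2 * (δm - δp)

/-- Coefficient `d₂` of the EIH metric function. -/
noncomputable def d2EIH (δp δm Λ R2 q2 : ℝ) : ℝ :=
  (Λ * R2 / 3) * (4 * π * (1 - Λ * R2) + (δm + δp) - q2)

/-- Coefficient `c₀` of the EIH metric function. -/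
noncomputable def c0EIH (δp δm Λ R2 q2 : ℝ) : ℝ :=
  4 * π * (1 - Λ * R2 / 3) + (δm + δp) + q2

/-- Coefficient `c₁` of the EIH metric function. -/
noncomputable def c1EIH (δp δm Λ R2 q2 : ℝ) : ℝ :=
  2 * (δm - δp)

/-- Coefficient `c₂` of the EIH metric function. -/
noncomputable def c2EIH (δp δm Λ R2 q2 : ℝ) : ℝ :=
  4 * π * (1 - Λ * R2) + (δm + δp) - q2

/-- The metric function `f_EIH` of an axially symmetric extremal isolated horizon with
deficit angles `δp`, `δm` at the poles `ζ = ±1`, cosmological constant `Λ`,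
squared radius `R2 = R²` (area `4πR²`) and dimensionless charge parameter `q2 = q²`. -/
noncomputable def fEIH (δp δm Λ R2 q2 : ℝ) (ζ : ℝ) : ℝ :=
  (1 - ζ ^ 2) *
      (d0EIH δp δm Λ R2 q2 + d1EIH δp δm Λ R2 q2 * ζ + d2EIH δp δm Λ R2 q2 * ζ ^ 2) /
    (c0EIH δp δm Λ R2 q2 + c1EIH δp δm Λ R2 q2 * ζ + c2EIH δp δm Λ R2 q2 * ζ ^ 2)

/-- At a point `x` with `x ^ 2 = 1`, only the derivative of the factor `1 - z ^ 2` contributes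
to the derivative of `(1 - z ^ 2) * D z / C z`, for quadratic `D` and `C` with `C x ≠ 0`. -/
theorem hasDerivAt_one_sub_sq_mul_quadratic_div (d₀ d₁ d₂ : ℝ) {c₀ c₁ c₂ x : ℝ}
    (hx : x ^ 2 = 1) (hc : c₀ + c₁ * x + c₂ * x ^ 2 ≠ 0) :
    HasDerivAt
      (fun z : ℝ => (1 - z ^ 2) * (d₀ + d₁ * z + d₂ * z ^ 2) / (c₀ + c₁ * z + c₂ * z ^ 2))
      (-2 * x * (d₀ + d₁ * x + d₂ * x ^ 2) / (c₀ + c₁ * x + c₂ * x ^ 2)) x := by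
  have quadratic (a b c : ℝ) :
      HasDerivAt (fun z : ℝ => a + b * z + c * z ^ 2) (b + c * (2 * x)) x := by
    simpa using (((hasDerivAt_id x).const_mul b).const_add a).fun_add
      ((hasDerivAt_pow 2 x).const_mul c)
  have factor : HasDerivAt (fun z : ℝ => 1 - z ^ 2) (-(2 * x)) x := by
    simpa using (hasDerivAt_pow 2 x).const_sub 1
  refine ((factor.mul (quadratic d₀ d₁ d₂)).div (quadratic c₀ c₁ c₂) hc).congr_deriv ?_
  simp only [Pi.mul_apply, sub_eq_zero.mpr hx.symm, zero_mul, add_zero, sub_zero]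
  rw [div_eq_div_iff (pow_ne_zero 2 hc) hc]
  ring

/-- The derivative of `f_EIH` at a pole `ζ = ±1`. -/
theorem deriv_fEIH_of_sq_eq_one {δp δm Λ R2 q2 ζ : ℝ} (hζ : ζ ^ 2 = 1)
    (hc : c0EIH δp δm Λ R2 q2 + c1EIH δp δm Λ R2 q2 * ζ + c2EIH δp δm Λ R2 q2 * ζ ^ 2 ≠ 0) :
    deriv (fEIH δp δm Λ R2 q2) ζ =
      -2 * ζ *
          (d0EIH δp δm Λ R2 q2 + d1EIH δp δm Λ R2 q2 * ζ + d2EIH δp δm Λ R2 q2 * ζ ^ 2) /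
        (c0EIH δp δm Λ R2 q2 + c1EIH δp δm Λ R2 q2 * ζ + c2EIH δp δm Λ R2 q2 * ζ ^ 2) :=
  (hasDerivAt_one_sub_sq_mul_quadratic_div _ _ _ hζ hc).deriv

/-- `f_EIH` vanishes at the poles `ζ = ±1` and its derivative satisfies
the generalized regularity conditions `f_EIH′(±1) = ∓2(1 + δ±/(2π))`. -/
theorem fEIH_boundary_values_and_regularity
    (δp δm Λ R q2 : ℝ) (hR : 0 < R)
    (h1 : c0EIH δp δm Λ (R ^ 2) q2 + c1EIH δp δm Λ (R ^ 2) q2 + c2EIH δp δm Λ (R ^ 2) q2 ≠ 0)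
    (h2 : c0EIH δp δm Λ (R ^ 2) q2 - c1EIH δp δm Λ (R ^ 2) q2 + c2EIH δp δm Λ (R ^ 2) q2 ≠ 0) :
    fEIH δp δm Λ (R ^ 2) q2 1 = 0 ∧ fEIH δp δm Λ (R ^ 2) q2 (-1) = 0 ∧
    deriv (fEIH δp δm Λ (R ^ 2) q2) 1 = -2 * (1 + δp / (2 * π)) ∧
    deriv (fEIH δp δm Λ (R ^ 2) q2) (-1) = 2 * (1 + δm / (2 * π)) := by
  have hπ : π ≠ 0 := pi_ne_zero
  refine ⟨by simp [fEIH], by simp [fEIH], ?_, ?_⟩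
  · have h1' : c0EIH δp δm Λ (R ^ 2) q2 + c1EIH δp δm Λ (R ^ 2) q2 * 1 +
        c2EIH δp δm Λ (R ^ 2) q2 * 1 ^ 2 ≠ 0 := by simpa using h1
    rw [deriv_fEIH_of_sq_eq_one (one_pow 2) h1', div_eq_iff h1']
    simp only [c0EIH, c1EIH, c2EIH, d0EIH, d1EIH, d2EIH]
    field_simp
    ring
  · have h2' : c0EIH δp δm Λ (R ^ 2) q2 + c1EIH δp δm Λ (R ^ 2) q2 * (-1) +
        c2EIH δp δm Λ (R ^ 2) q2 * (-1) ^ 2 ≠ 0 := by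
      convert h2 using 1
      ring
    rw [deriv_fEIH_of_sq_eq_one (by norm_num) h2', div_eq_iff h2']
    simp only [c0EIH, c1EIH, c2EIH, d0EIH, d1EIH, d2EIH]
    field_simp
    ring
end

section
/- Let a, l, e, g be real numbers with a ≠ 0 and l² ≤ a². Then (7a² + 6e² + 6g²)² ≥ a²(a² + 48l²), so that Λ⁺ := 3[7a² + 6e² + 6g² + √((7a² + 6e² + 6g²)² − a²(a² + 48l²))] / (a²(a² + 48l²)) is a well-defined real number, and moreover Λ⁺ · (a²/3 + 2l²) ≥ 1. -/
/-- For `a ≠ 0` and `l² ≤ a²`, the discriminant expression is nonnegative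
(so `Λ⁺` is a well-defined real number), and `Λ⁺ · (a²/3 + 2l²) ≥ 1`. -/
theorem LambdaPlus_no_positive_root
    (a l e g : ℝ) (ha : a ≠ 0) (hl : l ^ 2 ≤ a ^ 2) :
    (7 * a ^ 2 + 6 * e ^ 2 + 6 * g ^ 2) ^ 2 ≥ a ^ 2 * (a ^ 2 + 48 * l ^ 2) ∧
    3 * (7 * a ^ 2 + 6 * e ^ 2 + 6 * g ^ 2 +
          Real.sqrt ((7 * a ^ 2 + 6 * e ^ 2 + 6 * g ^ 2) ^ 2 - a ^ 2 * (a ^ 2 + 48 * l ^ 2))) /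
        (a ^ 2 * (a ^ 2 + 48 * l ^ 2)) * (a ^ 2 / 3 + 2 * l ^ 2) ≥ 1 := by
  have hA : 0 < a ^ 2 := by positivity
  have hS : 7 * a ^ 2 ≤ 7 * a ^ 2 + 6 * e ^ 2 + 6 * g ^ 2 := by
    nlinarith [sq_nonneg e, sq_nonneg g]
  have hAL : a ^ 2 * l ^ 2 ≤ a ^ 2 * a ^ 2 := mul_le_mul_of_nonneg_left hl hA.le
  refine ⟨?_, ?_⟩
  · have hS2 := pow_le_pow_left₀ (by positivity) hS 2
    linarith
  · have hr := Real.sqrt_nonneg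
      ((7 * a ^ 2 + 6 * e ^ 2 + 6 * g ^ 2) ^ 2 - a ^ 2 * (a ^ 2 + 48 * l ^ 2))
    have hD : 0 < a ^ 2 * (a ^ 2 + 48 * l ^ 2) := by positivity
    rw [ge_iff_le, div_mul_eq_mul_div, le_div_iff₀ hD]
    have hmul := mul_le_mul_of_nonneg_right (add_le_add hS hr)
      (by positivity : 0 ≤ a ^ 2 + 6 * l ^ 2)
    linarith
end

section
/- Let A₀ < 0, β > 0, k ≠ 0 and c₁ be real, and set S = √(c₁²β² + 16A₀²k²). Define δ₊ = (π/(2k²))(S − c₁β) − 2π and δ₋ = (π/(2k²))(S + c₁β) − 2π. Then for every ζ ∈ (−1,1), (2/π)·(2π+δ₋)(2π+δ₊)(1−ζ²) / [4π(1+ζ²) + δ₋(1+ζ)² + δ₊(1−ζ)²] = 8A₀²(1−ζ²) / [S(1+ζ²) + 2c₁βζ]. -/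
open Real

/-- For `Λ = 0`, the metric function of an uncharged extremal isolated
horizon with deficit angles `δ₊`, `δ₋` determined by the Kunduri–Lucietti near-horizon data
`A₀ < 0`, `β > 0`, `k ≠ 0`, `c₁` equals the Kunduri–Lucietti metric function in canonical
coordinates. -/
theorem fEIH_eq_KunduriLucietti_LambdaZero
    (A0 β k c1 : ℝ) (hA0 : A0 < 0) (hβ : 0 < β) (hk : k ≠ 0)
    (S δp δm : ℝ)
    (hS : S = Real.sqrt (c1 ^ 2 * β ^ 2 + 16 * A0 ^ 2 * k ^ 2))
    (hδp : δp = (π / (2 * k ^ 2)) * (S - c1 * β) - 2 * π)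
    (hδm : δm = (π / (2 * k ^ 2)) * (S + c1 * β) - 2 * π) :
    ∀ ζ : ℝ, -1 < ζ → ζ < 1 →
      (2 / π) * ((2 * π + δm) * (2 * π + δp) * (1 - ζ ^ 2)) /
          (4 * π * (1 + ζ ^ 2) + δm * (1 + ζ) ^ 2 + δp * (1 - ζ) ^ 2)
        = 8 * A0 ^ 2 * (1 - ζ ^ 2) / (S * (1 + ζ ^ 2) + 2 * c1 * β * ζ) := by
  intro ζ _ _
  have hS2 : S ^ 2 = c1 ^ 2 * β ^ 2 + 16 * A0 ^ 2 * k ^ 2 := by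
    rw [hS, Real.sq_sqrt (by positivity)]
  have hfac : π / k ^ 2 ≠ 0 := by positivity
  have hnum : (2 / π) * ((2 * π + δm) * (2 * π + δp) * (1 - ζ ^ 2)) =
      π / k ^ 2 * (8 * A0 ^ 2 * (1 - ζ ^ 2)) := by
    rw [hδp, hδm]
    field_simp
    linear_combination (1 - ζ ^ 2) * hS2
  have hden : 4 * π * (1 + ζ ^ 2) + δm * (1 + ζ) ^ 2 + δp * (1 - ζ) ^ 2 =
      π / k ^ 2 * (S * (1 + ζ ^ 2) + 2 * c1 * β * ζ) := by
    rw [hδp, hδm]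
    ring
  rw [hnum, hden, mul_div_mul_left _ _ hfac]
end

section
/- Let Λ ≠ 0, β > 0, k ≠ 0, A₀ be real, define Γ(x) = k²/β + βx²/4 and P(x) = −(βΛ/12)x⁴ + (A₀ − 2Λk²/β)x² − (4k²/β²)(A₀ − Λk²/β), and let x₁ > 0 satisfy P(x₁) = 0. Set R² = x₁, q² = 0, and δ₊ = δ₋ = δ := −π P′(x₁)/Γ(x₁) − 2π. Then for every ζ ∈ [−1,1] at which c₀ + c₂ζ² ≠ 0, the metric function f_EIH(ζ) equals P(x₁ζ)/(x₁ Γ(x₁ζ)). -/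
open Real

/-- For the Kunduri–Lucietti near-horizon geometry with cosmological
constant `Λ ≠ 0` and `c₁ = 0` (so `P` is biquadratic with positive root `x₁`), the horizon
metric function in canonical coordinates `ζ ↦ P(x₁ζ)/(x₁Γ(x₁ζ))` coincides with `f_EIH`
built from `R² = x₁`, `q² = 0` and the common deficit angle `δ = −πP′(x₁)/Γ(x₁) − 2π`. -/
theorem fEIH_eq_KunduriLucietti_metric_function
    (Λ β k A0 x1 : ℝ) (hΛ : Λ ≠ 0) (hβ : 0 < β) (hk : k ≠ 0) (hx1 : 0 < x1)
    (Γ P : ℝ → ℝ)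
    (hΓ : Γ = fun x => k ^ 2 / β + β * x ^ 2 / 4)
    (hP : P = fun x => -(β * Λ / 12) * x ^ 4 + (A0 - 2 * Λ * k ^ 2 / β) * x ^ 2
      - (4 * k ^ 2 / β ^ 2) * (A0 - Λ * k ^ 2 / β))
    (hroot : P x1 = 0)
    (R2 δ : ℝ) (hR2 : R2 = x1)
    (hδ : δ = -π * deriv P x1 / Γ x1 - 2 * π) :
    ∀ ζ : ℝ, ζ ∈ Set.Icc (-1 : ℝ) 1 →
      c0EIH δ δ Λ R2 0 + c2EIH δ δ Λ R2 0 * ζ ^ 2 ≠ 0 →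
      fEIH δ δ Λ R2 0 ζ = P (x1 * ζ) / (x1 * Γ (x1 * ζ)) := by
  intro ζ _ _
  have hβ' : β ≠ 0 := hβ.ne'
  have hx' : x1 ≠ 0 := hx1.ne'
  obtain ⟨K, hK⟩ : ∃ K, K = k ^ 2 / β := ⟨_, rfl⟩
  have hKpos : 0 < K := by rw [hK]; positivity
  have hP' : P = fun x => -(β * Λ / 12) * x ^ 4 + (A0 - 2 * Λ * K) * x ^ 2
      - (4 * K / β) * (A0 - Λ * K) := by
    rw [hP]; funext x; rw [hK]; field_simp
  have hΓ' : Γ = fun x => K + β * x ^ 2 / 4 := by rw [hΓ, hK]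
  have hder : deriv P x1 = -(β * Λ / 12) * (4 * x1 ^ 3) + (A0 - 2 * Λ * K) * (2 * x1) := by
    have h : HasDerivAt P
        (-(β * Λ / 12) * (4 * x1 ^ 3) + (A0 - 2 * Λ * K) * (2 * x1)) x1 := by
      rw [hP']
      simpa using (((hasDerivAt_pow 4 x1).const_mul (-(β * Λ / 12))).add
        ((hasDerivAt_pow 2 x1).const_mul (A0 - 2 * Λ * K))).sub_const
          ((4 * K / β) * (A0 - Λ * K))
    exact h.deriv
  rw [hder] at hδ
  clear hder hP hΓ hK
  subst hP' hΓ'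
  obtain ⟨v, hv⟩ : ∃ v, v = β * x1 ^ 2 / 4 := ⟨_, rfl⟩
  have hvpos : 0 < v := by rw [hv]; positivity
  have hβv : β = 4 * v / x1 ^ 2 := by rw [hv]; field_simp
  clear hv
  subst hβv
  have hv' : v ≠ 0 := hvpos.ne'
  have hlin : A0 * (v - K) = Λ * (v ^ 2 / 3 + 2 * K * v - K ^ 2) := by
    field_simp at hroot
    apply mul_left_cancel₀ (pow_ne_zero 2 hx')
    linear_combination (1 / 12 : ℝ) * hroot
  have hw : v - K ≠ 0 := by
    intro h
    have hvK : v = K := by linarith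
    rw [hvK] at hlin
    have h0 : Λ * K ^ 2 = 0 := by linear_combination (-3 / 4 : ℝ) * hlin
    exact mul_ne_zero hΛ (pow_ne_zero 2 hKpos.ne') h0
  have hA : A0 = Λ * (v ^ 2 / 3 + 2 * K * v - K ^ 2) / (v - K) := by
    rw [eq_div_iff hw, hlin]
  have hG : K + v ≠ 0 := by positivity
  have hδ' : δ = π * (2 * x1 * Λ * (v - 3 * K) / (3 * (v - K))) - 2 * π := by
    rw [hδ, hA]
    have e : K + 4 * v / x1 ^ 2 * x1 ^ 2 / 4 = K + v := by field_simp
    simp only [e]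
    field_simp
    ring
  have hGζ : K + v * ζ ^ 2 ≠ 0 := by positivity
  have hc : c0EIH δ δ Λ R2 0 + c1EIH δ δ Λ R2 0 * ζ + c2EIH δ δ Λ R2 0 * ζ ^ 2
      = -(8 * π * x1 * Λ / (3 * (v - K))) * (K + v * ζ ^ 2) := by
    rw [hR2, hδ']
    unfold c0EIH c1EIH c2EIH
    field_simp
    ring
  have e : K + 4 * v / x1 ^ 2 * (x1 * ζ) ^ 2 / 4 = K + v * ζ ^ 2 := by field_simp
  have hπ := Real.pi_ne_zero
  have hc' : -(8 * π * x1 * Λ / (3 * (v - K))) ≠ 0 :=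
    neg_ne_zero.2 (div_ne_zero (by positivity) (mul_ne_zero three_ne_zero hw))
  unfold fEIH
  rw [hc]
  simp only [e]
  rw [div_eq_div_iff (mul_ne_zero hc' hGζ) (mul_ne_zero hx' hGζ), hR2, hδ', hA]
  unfold d0EIH d1EIH d2EIH
  field_simp
  ring
end

section
/- Let a, l, Λ, C, r_H be real numbers with C ≠ 0, r_H² + (a−l)² ≠ 0, and 1 − (Λ/3)(2r_H² + 2l² + a²) ≠ 0. Define R² = C[r_H² + (a+l)²], δ₊ = 2πC[1 + (Λ/3)a(a+4l)] − 2π, δ₋ = 2πC[1 + (Λ/3)a(a−4l)]·(r_H² + (a+l)²)/(r_H² + (a−l)²) − 2π, and q² = 4πC·[ (r_H² + l²)(1 − Λ(r_H² + l²)) − a²(1 + Λ(r_H²/3 − l²)) ] / (r_H² + (a−l)²). Then for every ζ ∈ ℝ with r_H² + (l + aζ)² ≠ 0, the metric function f_EIH(ζ) built from (δ₊, δ₋, Λ, R², q²) equals f_D(ζ) := C[r_H² + (a+l)²](1−ζ²)·(1 + (4/3)Λalζ + (1/3)Λa²ζ²) / (r_H² + (l + aζ)²). In particular, setting Ξ =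 8πC[1 − (Λ/3)(2r_H² + 2l² + a²)]/(r_H² + (a−l)²), the coefficients satisfy c₀ = Ξ(r_H² + l²), c₁ = Ξ·2al, c₂ = Ξa², d₀ = CΞ[r_H² + (a+l)²], d₁ = CΞ[r_H² + (a+l)²]·(4/3)Λal, and d₂ = CΞ[r_H² + (a+l)²]·(1/3)Λa². -/
open Real

/-- The metric function of the extremal horizon of a non-accelerating
Kerr-Newman-NUT-(anti-)de Sitter black hole coincides with `f_EIH` for the stated choice
of `R²`, deficit angles `δ₊`, `δ₋` and charge parameter `q²`; moreover the coefficients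
of `f_EIH` factorize through `Ξ` as stated. -/
theorem fEIH_eq_fD_nonaccelerating
    (a l Λ C rH : ℝ) (hC : C ≠ 0)
    (h1 : rH ^ 2 + (a - l) ^ 2 ≠ 0)
    (h2 : 1 - (Λ / 3) * (2 * rH ^ 2 + 2 * l ^ 2 + a ^ 2) ≠ 0)
    (R2 δp δm q2 Ξ : ℝ)
    (hR2 : R2 = C * (rH ^ 2 + (a + l) ^ 2))
    (hδp : δp = 2 * π * C * (1 + (Λ / 3) * a * (a + 4 * l)) - 2 * π)
    (hδm : δm = 2 * π * C * (1 + (Λ / 3) * a * (a - 4 * l)) *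
      ((rH ^ 2 + (a + l) ^ 2) / (rH ^ 2 + (a - l) ^ 2)) - 2 * π)
    (hq2 : q2 = 4 * π * C *
      ((rH ^ 2 + l ^ 2) * (1 - Λ * (rH ^ 2 + l ^ 2))
        - a ^ 2 * (1 + Λ * (rH ^ 2 / 3 - l ^ 2))) / (rH ^ 2 + (a - l) ^ 2))
    (hΞ : Ξ = 8 * π * C * (1 - (Λ / 3) * (2 * rH ^ 2 + 2 * l ^ 2 + a ^ 2)) /
      (rH ^ 2 + (a - l) ^ 2)) :
    (∀ ζ : ℝ, rH ^ 2 + (l + a * ζ) ^ 2 ≠ 0 →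
      fEIH δp δm Λ R2 q2 ζ =
        C * (rH ^ 2 + (a + l) ^ 2) * (1 - ζ ^ 2) *
            (1 + (4 / 3) * Λ * a * l * ζ + (1 / 3) * Λ * a ^ 2 * ζ ^ 2) /
          (rH ^ 2 + (l + a * ζ) ^ 2)) ∧
    c0EIH δp δm Λ R2 q2 = Ξ * (rH ^ 2 + l ^ 2) ∧
    c1EIH δp δm Λ R2 q2 = Ξ * (2 * a * l) ∧
    c2EIH δp δm Λ R2 q2 = Ξ * a ^ 2 ∧
    d0EIH δp δm Λ R2 q2 = C * Ξ * (rH ^ 2 + (a + l) ^ 2) ∧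
    d1EIH δp δm Λ R2 q2 = C * Ξ * (rH ^ 2 + (a + l) ^ 2) * ((4 / 3) * Λ * a * l) ∧
    d2EIH δp δm Λ R2 q2 = C * Ξ * (rH ^ 2 + (a + l) ^ 2) * ((1 / 3) * Λ * a ^ 2) := by
  have hπ : π ≠ 0 := Real.pi_ne_zero
  have hc0 : c0EIH δp δm Λ R2 q2 = Ξ * (rH ^ 2 + l ^ 2) := by
    unfold c0EIH; subst hR2 hδp hδm hq2 hΞ; field_simp; ring
  have hc1 : c1EIH δp δm Λ R2 q2 = Ξ * (2 * a * l) := by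
    unfold c1EIH; subst hR2 hδp hδm hq2 hΞ; field_simp; ring
  have hc2 : c2EIH δp δm Λ R2 q2 = Ξ * a ^ 2 := by
    unfold c2EIH; subst hR2 hδp hδm hq2 hΞ; field_simp; ring
  have hd0 : d0EIH δp δm Λ R2 q2 = C * Ξ * (rH ^ 2 + (a + l) ^ 2) := by
    unfold d0EIH; subst hR2 hδp hδm hq2 hΞ; field_simp; ring
  have hd1 : d1EIH δp δm Λ R2 q2 =
      C * Ξ * (rH ^ 2 + (a + l) ^ 2) * ((4 / 3) * Λ * a * l) := by
    unfold d1EIH; subst hR2 hδp hδm hq2 hΞ; field_simp; ring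
  have hd2 : d2EIH δp δm Λ R2 q2 =
      C * Ξ * (rH ^ 2 + (a + l) ^ 2) * ((1 / 3) * Λ * a ^ 2) := by
    unfold d2EIH; subst hR2 hδp hδm hq2 hΞ; field_simp; ring
  have hΞ0 : Ξ ≠ 0 := by
    rw [hΞ]
    exact div_ne_zero (mul_ne_zero (by simp [hπ, hC]) h2) h1
  refine ⟨fun ζ _ => ?_, hc0, hc1, hc2, hd0, hd1, hd2⟩
  unfold fEIH
  rw [hc0, hc1, hc2, hd0, hd1, hd2, ← mul_div_mul_left _ (rH ^ 2 + (l + a * ζ) ^ 2) hΞ0]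
  congr 1 <;> ring
end

section
/- Let a, l, e, g, Λ be real numbers with Λ ≠ 0, set D = 1 − Λ(14a²/3 + 4e² + 4g²) + Λ²a²(a²/9 + 16l²/3), and assume D ≥ 0. Let r_H be a real number with r_H² + l² = (1/(2Λ))[1 − Λa²/3 − √D], and assume r_H² + (a−l)² ≠ 0 and 1 + Λa(5a/3 − 4l) − √D ≠ 0. Then ((r_H² + (a+l)²)/(r_H² + (a−l)²)) · [ (r_H² + l²)(1 − Λ(r_H² + l²)) − a²(1 + Λ(r_H²/3 − l²)) ] = ((1 + Λa(5a/3 + 4l) − √D)/(1 + Λa(5a/3 − 4l) − √D)) · (e² + g²). -/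
/-- Relation between the physically defined charges of the extremal
isolated horizon and the metric charge parameters `e`, `g` of the
Kerr-Newman-NUT-(anti-)de Sitter spacetime. -/
theorem physical_charges_vs_metric_charges
    (a l e g Λ : ℝ) (hΛ : Λ ≠ 0) (D : ℝ)
    (hDdef : D = 1 - Λ * (14 * a ^ 2 / 3 + 4 * e ^ 2 + 4 * g ^ 2)
      + Λ ^ 2 * a ^ 2 * (a ^ 2 / 9 + 16 * l ^ 2 / 3))
    (hD : 0 ≤ D) (rH : ℝ)
    (hrH : rH ^ 2 + l ^ 2 = (1 / (2 * Λ)) * (1 - Λ * a ^ 2 / 3 - Real.sqrt D))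
    (h1 : rH ^ 2 + (a - l) ^ 2 ≠ 0)
    (h2 : 1 + Λ * a * (5 * a / 3 - 4 * l) - Real.sqrt D ≠ 0) :
    ((rH ^ 2 + (a + l) ^ 2) / (rH ^ 2 + (a - l) ^ 2)) *
        ((rH ^ 2 + l ^ 2) * (1 - Λ * (rH ^ 2 + l ^ 2))
          - a ^ 2 * (1 + Λ * (rH ^ 2 / 3 - l ^ 2)))
      = ((1 + Λ * a * (5 * a / 3 + 4 * l) - Real.sqrt D) /
          (1 + Λ * a * (5 * a / 3 - 4 * l) - Real.sqrt D)) * (e ^ 2 + g ^ 2) := by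
  have hs : Real.sqrt D = 1 - Λ * a ^ 2 / 3 - 2 * Λ * (rH ^ 2 + l ^ 2) := by
    rw [hrH]
    field_simp
    ring
  have hsq : Real.sqrt D ^ 2 = D := Real.sq_sqrt hD
  have hnum : 1 + Λ * a * (5 * a / 3 + 4 * l) - Real.sqrt D
      = 2 * Λ * (rH ^ 2 + (a + l) ^ 2) := by
    rw [hs]
    ring
  have hden : 1 + Λ * a * (5 * a / 3 - 4 * l) - Real.sqrt D
      = 2 * Λ * (rH ^ 2 + (a - l) ^ 2) := by
    rw [hs]
    ring
  have hcharge : (rH ^ 2 + l ^ 2) * (1 - Λ * (rH ^ 2 + l ^ 2))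
      - a ^ 2 * (1 + Λ * (rH ^ 2 / 3 - l ^ 2)) = e ^ 2 + g ^ 2 := by
    rw [hs, hDdef] at hsq
    apply mul_left_cancel₀ (mul_ne_zero four_ne_zero hΛ)
    linear_combination -hsq
  rw [hnum, hden, hcharge, mul_div_mul_left _ _ (mul_ne_zero two_ne_zero hΛ)]
end

section
/- Let a, e, g, Λ be real numbers with Λ ≠ 0, set D₀ = 1 − Λ(14a²/3 + 4e² + 4g²) + Λ²a⁴/9, and assume D₀ ≥ 0, 1 + Λa²/3 ≠ 0, and 1 + (5/3)Λa² − √D₀ ≠ 0. Let r_H² = (1/(2Λ))[1 − Λa²/3 − √D₀] and assume r_H² + a² ≠ 0. Then (i) with C = (1 + Λa²/3)⁻¹, both deficit angles δ₊ = 2πC(1 + Λa²/3) − 2π and δ₋ = 2πC(1 + Λa²/3) − 2π vanish, and (ii) 4π · [ r_H² − a² − (Λ/3) r_H² (3r_H² + a²) ] / [ (r_H² + a²)(1 + Λa²/3) ] = 8πΛ(e² + g²) / [ (1 + Λa²/3)(1 + (5/3)Λa² − √D₀) ]. -/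
open Real

/-- For the extremal Kerr-Newman-(anti-)de Sitter black hole (`l = 0`):
(i) with conicity `C = (1 + Λa²/3)⁻¹` both deficit angles vanish, and (ii) the two
expressions for the dimensionless charge parameter `q²` coincide. -/
theorem KerrNewmanAdS_regular_poles_and_charge
    (a e g Λ : ℝ) (hΛ : Λ ≠ 0) (D0 : ℝ)
    (hD0def : D0 = 1 - Λ * (14 * a ^ 2 / 3 + 4 * e ^ 2 + 4 * g ^ 2) + Λ ^ 2 * a ^ 4 / 9)
    (hD0 : 0 ≤ D0)
    (h1 : 1 + Λ * a ^ 2 / 3 ≠ 0)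
    (h2 : 1 + (5 / 3) * Λ * a ^ 2 - Real.sqrt D0 ≠ 0)
    (rH2 : ℝ) (hrH2 : rH2 = (1 / (2 * Λ)) * (1 - Λ * a ^ 2 / 3 - Real.sqrt D0))
    (h3 : rH2 + a ^ 2 ≠ 0)
    (C : ℝ) (hC : C = (1 + Λ * a ^ 2 / 3)⁻¹) :
    (2 * π * C * (1 + Λ * a ^ 2 / 3) - 2 * π = 0 ∧
      2 * π * C * (1 + Λ * a ^ 2 / 3) - 2 * π = 0) ∧
    4 * π * (rH2 - a ^ 2 - (Λ / 3) * rH2 * (3 * rH2 + a ^ 2)) /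
        ((rH2 + a ^ 2) * (1 + Λ * a ^ 2 / 3))
      = 8 * π * Λ * (e ^ 2 + g ^ 2) /
        ((1 + Λ * a ^ 2 / 3) * (1 + (5 / 3) * Λ * a ^ 2 - Real.sqrt D0)) := by
  have h_deficit : 2 * π * C * (1 + Λ * a ^ 2 / 3) - 2 * π = 0 := by
    rw [hC, mul_assoc, inv_mul_cancel₀ h1, mul_one, sub_self]
  refine ⟨⟨h_deficit, h_deficit⟩, ?_⟩
  have h_sqrt : Real.sqrt D0 = 1 - Λ * a ^ 2 / 3 - 2 * Λ * rH2 := by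
    rw [hrH2]
    field_simp
    ring
  have h_sq : (1 - Λ * a ^ 2 / 3 - 2 * Λ * rH2) ^ 2 = D0 := by
    rw [← h_sqrt, Real.sq_sqrt hD0]
  have h_charge : rH2 - a ^ 2 - (Λ / 3) * rH2 * (3 * rH2 + a ^ 2) = e ^ 2 + g ^ 2 := by
    apply mul_left_cancel₀ hΛ
    linear_combination (-1 / 4) * h_sq - (1 / 4) * hD0def
  have h_area : 1 + (5 / 3) * Λ * a ^ 2 - Real.sqrt D0 = 2 * Λ * (rH2 + a ^ 2) := by
    rw [h_sqrt]
    ring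
  rw [h_charge, h_area, div_eq_div_iff (mul_ne_zero h3 h1)
    (mul_ne_zero h1 (mul_ne_zero (mul_ne_zero two_ne_zero hΛ) h3))]
  ring
end

section
/- Let Λ, R, C be real numbers with R > 0, set δ₊ = δ₋ = 2π(C − 1) and q² = 4π(C − ΛR²). Then for every ζ ∈ ℝ at which c₀ + c₂ζ² ≠ 0, the metric function f_EIH(ζ) equals C(1 − ζ²). -/
open Real

/-- With equal deficit angles `δ₊ = δ₋ = 2π(C−1)` and charge parameter
`q² = 4π(C − ΛR²)`, the metric function `f_EIH` reduces to the quasi-regular sphere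
metric function `C(1 − ζ²)` (the horizon geometry of the non-rotating charged
NUT-(anti-)de Sitter extremal black hole). -/
theorem fEIH_quasiRegular_sphere
    (Λ R C : ℝ) (hR : 0 < R) (δ q2 : ℝ)
    (hδ : δ = 2 * π * (C - 1))
    (hq2 : q2 = 4 * π * (C - Λ * R ^ 2)) :
    ∀ ζ : ℝ, c0EIH δ δ Λ (R ^ 2) q2 + c2EIH δ δ Λ (R ^ 2) q2 * ζ ^ 2 ≠ 0 →
      fEIH δ δ Λ (R ^ 2) q2 ζ = C * (1 - ζ ^ 2) := by
  intro ζ hζ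
  have hd0 : d0EIH δ δ Λ (R ^ 2) q2 = C * c0EIH δ δ Λ (R ^ 2) q2 := by
    subst hδ hq2
    unfold d0EIH c0EIH
    field_simp
    ring
  have hd1 : d1EIH δ δ Λ (R ^ 2) q2 = 0 := by
    simp [d1EIH]
  have hc1 : c1EIH δ δ Λ (R ^ 2) q2 = 0 := by
    simp [c1EIH]
  have hc2 : c2EIH δ δ Λ (R ^ 2) q2 = 0 := by
    subst hδ hq2
    unfold c2EIH
    ring
  have hd2 : d2EIH δ δ Λ (R ^ 2) q2 = 0 := by
    subst hδ hq2
    unfold d2EIH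
    ring
  rw [hc2, zero_mul, add_zero] at hζ
  rw [fEIH, hd0, hd1, hd2, hc1, hc2]
  simp only [zero_mul, add_zero]
  field_simp
end

section
/- Let a, l, e, g, Λ be real numbers with Λ < 0, define D = 1 − Λ(14a²/3 + 4e² + 4g²) + Λ²a²(a²/9 + 16l²/3), s = a² + e² + g² − l² + Λl²(l² − a²), and x₋ = (1/(2Λ))[1 − Λ(a²/3 + 2l²) − √D]. Then the following are equivalent: (i) x₋ > 0; (ii) s > 0; (iii) l² < (l²)₋ := [1 + Λa² − √((1 + Λa²)² − 4Λ(a² + e² + g²))]/(2Λ). Moreover, if a² + e² + g² > 0 then (l²)₋ > 0. -/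
/-- In the anti-de Sitter case `Λ < 0`, the following are equivalent:
(i) the root `x₋` is positive; (ii) `s > 0`; (iii) `l² < (l²)₋`. Moreover, if
`a² + e² + g² > 0` then `(l²)₋ > 0`. -/
theorem extremal_BH_horizon_existence_AdS
    (a l e g Λ : ℝ) (hΛ : Λ < 0) (D s xm l2m : ℝ)
    (hD : D = 1 - Λ * (14 * a ^ 2 / 3 + 4 * e ^ 2 + 4 * g ^ 2)
      + Λ ^ 2 * a ^ 2 * (a ^ 2 / 9 + 16 * l ^ 2 / 3))
    (hs : s = a ^ 2 + e ^ 2 + g ^ 2 - l ^ 2 + Λ * l ^ 2 * (l ^ 2 - a ^ 2))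
    (hxm : xm = (1 / (2 * Λ)) * (1 - Λ * (a ^ 2 / 3 + 2 * l ^ 2) - Real.sqrt D))
    (hl2m : l2m = (1 + Λ * a ^ 2
      - Real.sqrt ((1 + Λ * a ^ 2) ^ 2 - 4 * Λ * (a ^ 2 + e ^ 2 + g ^ 2))) / (2 * Λ)) :
    ((0 < xm ↔ 0 < s) ∧ (0 < s ↔ l ^ 2 < l2m)) ∧
    (0 < a ^ 2 + e ^ 2 + g ^ 2 → 0 < l2m) := by
  have two_mul_neg : 2 * Λ < 0 := by linarith
  set q := a ^ 2 + e ^ 2 + g ^ 2 with hq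
  set c := 1 + Λ * a ^ 2 with hc
  refine ⟨⟨?_, ?_⟩, fun hq_pos => ?_⟩
  · have B_nonneg : 0 ≤ 1 - Λ * (a ^ 2 / 3 + 2 * l ^ 2) := by
      nlinarith [mul_nonneg (neg_nonneg.2 hΛ.le)
        (by positivity : 0 ≤ a ^ 2 / 3 + 2 * l ^ 2)]
    have D_eq : D = (1 - Λ * (a ^ 2 / 3 + 2 * l ^ 2)) ^ 2 + 4 * (-Λ * s) := by
      rw [hD, hs, hq]; ring
    have xm_pos_iff : 0 < xm ↔ 1 - Λ * (a ^ 2 / 3 + 2 * l ^ 2) < √D := by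
      rw [hxm, one_div_mul_eq_div, lt_div_iff_of_neg two_mul_neg, zero_mul, sub_neg]
    have s_pos_iff : 0 < -Λ * s ↔ 0 < s := mul_pos_iff_of_pos_left (neg_pos.2 hΛ)
    rw [xm_pos_iff, Real.lt_sqrt B_nonneg, D_eq, ← s_pos_iff]
    constructor <;> intro h <;> linarith
  · have lt_iff : l ^ 2 < l2m ↔ c - 2 * Λ * l ^ 2 < √(c ^ 2 - 4 * Λ * q) := by
      rw [hl2m, lt_div_iff_of_neg two_mul_neg]
      constructor <;> intro h <;> linarith
    have disc_eq : c ^ 2 - 4 * Λ * q = (c - 2 * Λ * l ^ 2) ^ 2 + 4 * (-Λ * s) := by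
      rw [hs, hc]; ring
    have s_pos_iff : 0 < -Λ * s ↔ 0 < s := mul_pos_iff_of_pos_left (neg_pos.2 hΛ)
    rw [lt_iff]
    rcases le_or_gt 0 (c - 2 * Λ * l ^ 2) with h | h
    · rw [Real.lt_sqrt h, disc_eq, ← s_pos_iff]
      constructor <;> intro h <;> linarith
    · refine iff_of_true ?_ (h.trans_le (Real.sqrt_nonneg _))
      have l_term_nonneg : 0 ≤ -Λ * l ^ 2 := mul_nonneg (neg_nonneg.2 hΛ.le) (sq_nonneg l)
      have a_sq_pos : 0 < a ^ 2 := by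
        by_contra! ha
        have : a ^ 2 = 0 := le_antisymm ha (sq_nonneg a)
        rw [hc, this] at h
        linarith
      have q_pos : 0 < q := by positivity
      have s_eq : s = q + l ^ 2 * (2 * Λ * l ^ 2 - c) + (-Λ * l ^ 2) * l ^ 2 := by
        rw [hs, hc]; ring
      have middle_nonneg : 0 ≤ l ^ 2 * (2 * Λ * l ^ 2 - c) :=
        mul_nonneg (sq_nonneg l) (by linarith)
      have := mul_nonneg l_term_nonneg (sq_nonneg l)
      linarith
  · rw [hl2m]
    refine div_pos_of_neg_of_neg (sub_neg.2 (Real.lt_sqrt_of_sq_lt ?_)) two_mul_neg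
    nlinarith [mul_pos (neg_pos.2 hΛ) hq_pos]
end

section
/- Define F : [0,1] → ℝ by F(ξ) = (7 + 4√3·√(1−ξ))(1 + 6ξ)/(1 + 48ξ). Then F is monotonously decreasing on [0,1], F(1) = 1, and consequently F(ξ) ≥ 1 for every ξ ∈ [0,1]. -/
/-- The function `F(ξ) = (7 + 4√3·√(1−ξ))(1+6ξ)/(1+48ξ)` is monotonously
decreasing on `[0,1]`, satisfies `F(1) = 1`, and consequently `F(ξ) ≥ 1` on `[0,1]`. -/
theorem F_strictAnti_and_ge_one :
    StrictAntiOn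
      (fun ξ : ℝ => (7 + 4 * Real.sqrt 3 * Real.sqrt (1 - ξ)) * (1 + 6 * ξ) / (1 + 48 * ξ))
      (Set.Icc (0 : ℝ) 1) ∧
    (7 + 4 * Real.sqrt 3 * Real.sqrt (1 - (1 : ℝ))) * (1 + 6 * (1 : ℝ)) / (1 + 48 * (1 : ℝ))
      = 1 ∧
    ∀ ξ ∈ Set.Icc (0 : ℝ) 1,
      (7 + 4 * Real.sqrt 3 * Real.sqrt (1 - ξ)) * (1 + 6 * ξ) / (1 + 48 * ξ) ≥ 1 := by
  have anti : StrictAntiOn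
      (fun ξ : ℝ => (7 + 4 * Real.sqrt 3 * Real.sqrt (1 - ξ)) * (1 + 6 * ξ) / (1 + 48 * ξ))
      (Set.Icc (0 : ℝ) 1) := by
    intro x hx y hy hxy
    have hx0 := hx.1
    have hy0 := hy.1
    have hfrac : (1 + 6 * y) / (1 + 48 * y) < (1 + 6 * x) / (1 + 48 * x) := by
      rw [div_lt_div_iff₀ (by positivity) (by positivity)]
      linarith
    have hsqrt : Real.sqrt (1 - y) ≤ Real.sqrt (1 - x) := Real.sqrt_le_sqrt (by linarith)
    simp only [mul_div_assoc]
    exact mul_lt_mul' (by gcongr) hfrac (by positivity) (by positivity)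
  have at_one : (7 + 4 * Real.sqrt 3 * Real.sqrt (1 - (1 : ℝ))) * (1 + 6 * (1 : ℝ))
      / (1 + 48 * (1 : ℝ)) = 1 := by
    norm_num
  refine ⟨anti, at_one, fun ξ hξ => ?_⟩
  have h := anti.antitoneOn hξ (Set.right_mem_Icc.mpr zero_le_one) hξ.2
  exact at_one.symm.trans_le h
end
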